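/- Let G be a group with a normal subgroup Z, and set Q = G/Z. Suppose that G is subgroup separable, Z is finitely generated, and Q is n-coset separable for some n ∈ ℕ. Let H₁,…,Hₙ be finitely generated subgroups of G and let K be a finite-index subgroup of Z. Then the product set H₁⋯HₙK = {h₁⋯hₙk : hᵢ ∈ Hᵢ, k ∈ K} is separable in G. -/

import Mathlib

open scoped Pointwise

/-- A subset `S` of a group `G` is separable if every `g ∉ S` is excluded from `S`
by a finite-index normal subgroup: `gN ∩ S = ∅`. -/
def SeparableSubset {G : Type*} [Group G] (S : Set G) : Prop :=
  ∀ g : G, g ∉ S → ∃ N : Subgroup G, N.Normal ∧ N.FiniteIndex ∧ ∀ x ∈ N, g * x ∉ S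

/-- A group is subgroup separable if each of its finitely generated subgroups is separable. -/
def SubgroupSeparable (G : Type*) [Group G] : Prop :=
  ∀ H : Subgroup G, H.FG → SeparableSubset (H : Set G)

/-- A group is double coset separable if the product of any two finitely generated
subgroups is separable. -/
def DoubleCosetSeparable (G : Type*) [Group G] : Prop :=
  ∀ H K : Subgroup G, H.FG → K.FG → SeparableSubset ((H : Set G) * (K : Set G))

/-- A group is `n`-coset separable if the product of any `n` finitely generated
subgroups is separable. -/
def NCosetSeparable (G : Type*) [Group G] (n : ℕ) : Prop :=
  ∀ H : Fin n → Subgroup G, (∀ i, (H i).FG) →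
    SeparableSubset ((List.ofFn fun i => ((H i : Set G))).prod)

/-- A group is product separable if it is `n`-coset separable for every `n`. -/
def ProductSeparable (G : Type*) [Group G] : Prop :=
  ∀ n : ℕ, NCosetSeparable G n

/-- A subgroup of the center is normal. -/
lemma normal_of_le_center {G : Type*} [Group G] {Z : Subgroup G}
    (hZ : Z ≤ Subgroup.center G) : Z.Normal :=
  ⟨fun z hz g => by
    have h : g * z = z * g := Subgroup.mem_center_iff.mp (hZ hz) g
    have : g * z * g⁻¹ = z := by rw [h]; group
    rw [this]; exact hz⟩

/-- `(h₁, …, hₙ)` is a product representative of `g` with respect to subgroups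
`H₁, …, Hₙ` if `hᵢ ∈ Hᵢ` for each `i` and `g = h₁ ⋯ hₙ`. -/
def IsProductRep {G : Type*} [Group G] {n : ℕ} (H : Fin n → Subgroup G) (g : G)
    (h : Fin n → G) : Prop :=
  (∀ i, h i ∈ H i) ∧ (List.ofFn h).prod = g

/-- Two product representatives `(h₁, …, hₙ)` and `(k₁, …, kₙ)` are equivalent if
there are elements `sᵢ ∈ Hᵢ ∩ Hᵢ₊₁` (with `s₀ = sₙ = 1`) such that
`sᵢ₋₁ kᵢ = hᵢ sᵢ` for each `i`.  Here `s` is indexed by the `n + 1` "boundaries". -/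
def RepEquiv {G : Type*} [Group G] {n : ℕ} (H : Fin n → Subgroup G)
    (h k : Fin n → G) : Prop :=
  ∃ s : Fin (n + 1) → G,
    s 0 = 1 ∧ s (Fin.last n) = 1 ∧
    (∀ i : Fin n, ∀ hi : (i : ℕ) + 1 < n, s i.succ ∈ H i ⊓ H ⟨(i : ℕ) + 1, hi⟩) ∧
    (∀ i : Fin n, s i.castSucc * k i = h i * s i.succ)

/-- A group has bottlenecked product representatives over a class `C` of subgroups
if for every `n ≥ 1`, subgroups `H₁, …, Hₙ ∈ C` and `g ∈ H₁ ⋯ Hₙ`, there is a set `R`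
of product representatives of `g` whose projection to some coordinate is finite,
such that every product representative of `g` is equivalent to a member of `R`. -/
def HasBottleneckedProductReps (G : Type*) [Group G] (C : Subgroup G → Prop) : Prop :=
  ∀ n : ℕ, 0 < n → ∀ H : Fin n → Subgroup G, (∀ i, C (H i)) →
    ∀ g ∈ (List.ofFn fun i => ((H i : Set G))).prod,
      ∃ R : Set (Fin n → G),
        (∀ h ∈ R, IsProductRep H g h) ∧
        (∃ i : Fin n, ((fun h : Fin n → G => h i) '' R).Finite) ∧
        (∀ h : Fin n → G, IsProductRep H g h → ∃ k ∈ R, RepEquiv H h k)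

/-- A group is residually finite if every nontrivial element survives in some
finite quotient. -/
def ResiduallyFinite (G : Type*) [Group G] : Prop :=
  ∀ g : G, g ≠ 1 → ∃ N : Subgroup G, N.Normal ∧ N.FiniteIndex ∧ g ∉ N


namespace SepAux

variable {G : Type*} [Group G]

lemma sep_inter {S T : Set G} (hS : SeparableSubset S) (hT : SeparableSubset T) :
    SeparableSubset (S ∩ T) := by
  intro g hg
  by_cases h : g ∈ S
  · obtain ⟨N, h1, h2, h3⟩ := hT g (fun h' => hg ⟨h, h'⟩)
    exact ⟨N, h1, h2, fun x hx h' => h3 x hx h'.2⟩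
  · obtain ⟨N, h1, h2, h3⟩ := hS g h
    exact ⟨N, h1, h2, fun x hx h' => h3 x hx h'.1⟩

lemma sep_biUnion {ι : Type*} {T : Set ι} (hT : T.Finite) (S : ι → Set G) :
    (∀ t ∈ T, SeparableSubset (S t)) → SeparableSubset (⋃ t ∈ T, S t) := by
  intro hS g hg
  suffices h : ∃ N : Subgroup G, N.Normal ∧ N.FiniteIndex ∧ ∀ t ∈ T, ∀ x ∈ N, g * x ∉ S t by
    obtain ⟨N, h1, h2, h3⟩ := h
    refine ⟨N, h1, h2, fun x hx h' => ?_⟩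
    simp only [Set.mem_iUnion] at h'
    obtain ⟨t, ht, h'⟩ := h'
    exact h3 t ht x hx h'
  have hg' : ∀ t ∈ T, g ∉ S t := by
    intro t ht h
    exact hg (Set.mem_biUnion ht h)
  clear hg
  induction T, hT using Set.Finite.induction_on with
  | empty => exact ⟨⊤, inferInstance, inferInstance, by simp⟩
  | @insert a s ha hs ih =>
    obtain ⟨N, h1, h2, h3⟩ := ih (fun t ht => hS t (Or.inr ht)) (fun t ht => hg' t (Or.inr ht))
    obtain ⟨N', h1', h2', h3'⟩ := hS a (Or.inl rfl) g (hg' a (Or.inl rfl))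
    refine ⟨N ⊓ N', inferInstance, inferInstance, ?_⟩
    rintro t (rfl | ht) x hx
    · exact h3' x hx.2
    · exact h3 t ht x hx.1

lemma exists_common {S : Set G} (hS : SeparableSubset S) {B : Set G} (hB : B.Finite)
    (hBS : ∀ b ∈ B, b ∉ S) :
    ∃ N : Subgroup G, N.Normal ∧ N.FiniteIndex ∧ ∀ b ∈ B, ∀ x ∈ N, b * x ∉ S := by
  induction B, hB using Set.Finite.induction_on with
  | empty => exact ⟨⊤, inferInstance, inferInstance, by simp⟩
  | @insert a s ha hs ih =>
    obtain ⟨N, h1, h2, h3⟩ := ih (fun t ht => hBS t (Or.inr ht))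
    obtain ⟨N', h1', h2', h3'⟩ := hS a (hBS a (Or.inl rfl))
    refine ⟨N ⊓ N', inferInstance, inferInstance, ?_⟩
    rintro t (rfl | ht) x hx
    · exact h3' x hx.2
    · exact h3 t ht x hx.1

lemma sep_translate {S : Set G} (hS : SeparableSubset S) (a : G) : SeparableSubset (a • S) := by
  intro g hg
  rw [Set.mem_smul_set_iff_inv_smul_mem] at hg
  obtain ⟨N, h1, h2, h3⟩ := hS _ hg
  refine ⟨N, h1, h2, fun x hx h => h3 x hx ?_⟩
  rw [Set.mem_smul_set_iff_inv_smul_mem] at h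
  simpa [smul_eq_mul, mul_assoc] using h

lemma transversal (H K : Subgroup G) (h : (K.subgroupOf H).FiniteIndex) :
    ∃ B : Set G, B.Finite ∧ (∀ b ∈ B, b ∈ H) ∧ ∀ x ∈ H, ∃ b ∈ B, b⁻¹ * x ∈ K := by
  refine ⟨Set.range (fun q : H ⧸ K.subgroupOf H => ((q.out : H) : G)), Set.finite_range _, ?_, ?_⟩
  · rintro _ ⟨q, rfl⟩
    exact (q.out).2
  · intro x hx
    refine ⟨_, ⟨((⟨x, hx⟩ : H) : H ⧸ K.subgroupOf H), rfl⟩, ?_⟩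
    have := QuotientGroup.eq.mp (Quotient.out_eq ((⟨x, hx⟩ : H) : H ⧸ K.subgroupOf H))
    simpa [Subgroup.mem_subgroupOf] using this

lemma fg_map {G' : Type*} [Group G'] (H : Subgroup G) (f : G →* G') (hH : H.FG) :
    (H.map f).FG := by
  classical
  obtain ⟨S, rfl⟩ := hH
  exact ⟨S.image f, by rw [MonoidHom.map_closure, Finset.coe_image]⟩

lemma fg_sub (H K : Subgroup G) (hH : H.FG) (h : (K.subgroupOf H).FiniteIndex) :
    (K ⊓ H).FG := by
  have : Group.FG H := (Group.fg_iff_subgroup_fg H).mpr hH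
  have h1 : (K.subgroupOf H).FG :=
    (Group.fg_iff_subgroup_fg _).mp (Subgroup.fg_of_index_ne_zero (K.subgroupOf H))
  have h2 := fg_map _ H.subtype h1
  rwa [Subgroup.subgroupOf_map_subtype] at h2

/-- product of a list of subgroups -/
def P (l : List (Subgroup G)) : Set G := (l.map (fun H : Subgroup G => (H : Set G))).prod

lemma P_cons (H : Subgroup G) (l : List (Subgroup G)) : P (H :: l) = (H : Set G) * P l := by
  simp [P]

lemma decomp (M : Subgroup G) [M.Normal] [M.FiniteIndex] (l : List (Subgroup G)) :
    (∀ H ∈ l, H.FG) → ∃ T : Set (G × List (Subgroup G)), T.Finite ∧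
      (∀ t ∈ T, t.2.length = l.length ∧ ∀ H ∈ t.2, H.FG ∧ H ≤ M) ∧
      P l = ⋃ t ∈ T, t.1 • P t.2 := by
  induction l with
  | nil =>
    intro _
    exact ⟨{(1, [])}, Set.finite_singleton _, by simp, by simp⟩
  | cons H l ih =>
    intro hl
    obtain ⟨T, hT, h1, h2⟩ := ih (fun K hK => hl K (List.mem_cons_of_mem _ hK))
    obtain ⟨B, hB, hBH, hBc⟩ := transversal H M inferInstance
    refine ⟨(fun p : G × (G × List (Subgroup G)) => (p.1 * p.2.1,
      (M ⊓ H).map (MulAut.conj p.2.1⁻¹).toMonoidHom :: p.2.2)) '' (B ×ˢ T),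
      (hB.prod hT).image _, ?_, ?_⟩
    · rintro _ ⟨⟨b, t⟩, ⟨hb, ht⟩, rfl⟩
      obtain ⟨h3, h4⟩ := h1 t ht
      refine ⟨by simp [h3], ?_⟩
      intro K hK
      rcases List.mem_cons.mp hK with rfl | hK
      · refine ⟨fg_map _ _ (fg_sub H M (hl H (by simp)) inferInstance), ?_⟩
        rintro _ ⟨x, hx, rfl⟩
        have := Subgroup.Normal.conj_mem ‹M.Normal› x hx.1 t.1⁻¹
        simpa using this
      · exact h4 K hK
    · ext x
      rw [P_cons, h2]
      simp only [Set.mem_iUnion, Set.mem_mul]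
      constructor
      · rintro ⟨h, hh, y, ⟨t, ht, p, hp, rfl⟩, rfl⟩
        obtain ⟨b, hb, hbm⟩ := hBc h hh
        refine ⟨_, ⟨⟨b, t⟩, ⟨hb, ht⟩, rfl⟩, ?_⟩
        rw [P_cons]
        refine ⟨t.1⁻¹ * (b⁻¹ * h) * t.1 * p, ?_, ?_⟩
        · refine Set.mul_mem_mul ⟨b⁻¹ * h, ⟨hbm, H.mul_mem (H.inv_mem (hBH b hb)) hh⟩, ?_⟩ hp
          simp
        · simp only [smul_eq_mul]; group
      · rintro ⟨_, ⟨⟨b, t⟩, ⟨hb, ht⟩, rfl⟩, hx⟩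
        rw [P_cons] at hx
        obtain ⟨_, ⟨_, ⟨m, hm, rfl⟩, p, hp, rfl⟩, rfl⟩ := hx
        refine ⟨b * m, H.mul_mem (hBH b hb) hm.2, t.1 * p, ⟨t, ht, p, hp, rfl⟩, ?_⟩
        simp [mul_assoc]

lemma P_le (M : Subgroup G) (l : List (Subgroup G)) (h : ∀ H ∈ l, H ≤ M) :
    P l ⊆ (M : Set G) := by
  induction l with
  | nil => simp [P, M.one_mem]
  | cons H l ih =>
    rw [P_cons]
    rintro _ ⟨a, ha, b, hb, rfl⟩
    exact M.mul_mem (h H (by simp) ha) (ih (fun K hK => h K (by simp [hK])) hb)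

lemma P_map {G' : Type*} [Group G'] (f : G →* G') (l : List (Subgroup G)) :
    P (l.map (Subgroup.map f)) = f '' P l := by
  induction l with
  | nil => simp [P, Set.singleton_one]
  | cons H l ih => rw [List.map_cons, P_cons, P_cons, ih, Set.image_mul]; rfl

lemma sep_preimage {G' : Type*} [Group G'] (f : G →* G') {S : Set G'} (hS : SeparableSubset S) :
    SeparableSubset (f ⁻¹' S) := by
  intro g hg
  obtain ⟨N, h1, h2, h3⟩ := hS _ hg
  refine ⟨N.comap f, inferInstance, ⟨?_⟩, fun x hx h => h3 (f x) hx ?_⟩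
  · rw [Subgroup.index_comap]
    exact (inferInstance : (N.subgroupOf f.range).FiniteIndex).index_ne_zero
  · simpa using h

lemma ncoset_list {n : ℕ} (hQ : NCosetSeparable G n) (l : List (Subgroup G))
    (hl : l.length = n) (h : ∀ H ∈ l, H.FG) : SeparableSubset (P l) := by
  subst hl
  have := hQ l.get (fun i => h _ (List.get_mem _ _))
  have e : (List.ofFn fun i => ((l.get i : Subgroup G) : Set G)) = l.map (fun H : Subgroup G => (H : Set G)) := by
    conv_rhs => rw [← List.ofFn_get l, List.map_ofFn]
    rfl
  rwa [e] at this

end SepAux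

open SepAux in
/-- if `G` is subgroup separable, `Z ⊴ G` finitely generated, `G/Z`
`n`-coset separable, then for finitely generated `H₁, …, Hₙ ≤ G` and finite-index
`K ≤ Z`, the product `H₁ ⋯ Hₙ K` is separable in `G`. -/
theorem prod_with_finite_index_in_kernel_separable
    (G : Type*) [Group G] (Z : Subgroup G) [Z.Normal]
    (hG : SubgroupSeparable G) (hZfg : Z.FG)
    (n : ℕ) (hQ : NCosetSeparable (G ⧸ Z) n)
    (H : Fin n → Subgroup G) (hH : ∀ i, (H i).FG)
    (K : Subgroup G) (hKZ : K ≤ Z) (hKfi : (K.subgroupOf Z).FiniteIndex) :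
    SeparableSubset ((List.ofFn fun i => ((H i : Set G))).prod * (K : Set G)) := by

  have hKfg : K.FG := by
    have := fg_sub Z K hZfg hKfi
    rwa [inf_eq_left.mpr hKZ] at this
  obtain ⟨B, hB, hBZ, hBc⟩ := transversal Z K hKfi
  obtain ⟨M, hMn, hMf, hM⟩ := exists_common (hG K hKfg) (B := B \ (K : Set G))
    (hB.subset Set.sdiff_subset) (fun b hb => hb.2)
  have hMZ : ∀ z ∈ M, z ∈ Z → z ∈ K := by
    intro z hzM hzZ
    obtain ⟨b, hb, hbk⟩ := hBc z hzZ
    by_cases hbK : b ∈ K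
    · simpa using K.mul_mem hbK hbk
    · exfalso
      refine hM b ⟨hb, hbK⟩ ((b⁻¹ * z) * z⁻¹ * (b⁻¹ * z)⁻¹)
        (hMn.conj_mem _ (M.inv_mem hzM) _) ?_
      have : b * ((b⁻¹ * z) * z⁻¹ * (b⁻¹ * z)⁻¹) = (b⁻¹ * z)⁻¹ := by group
      rw [this]
      exact K.inv_mem hbk
  have e : (List.ofFn fun i => ((H i : Set G))).prod = P (List.ofFn H) := by
    simp [P, List.map_ofFn, Function.comp_def]
  obtain ⟨T, hT, h1, h2⟩ := decomp M (List.ofFn H) (by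
    intro K hK
    obtain ⟨i, rfl⟩ := (List.mem_ofFn' _ _).mp hK
    exact hH i)
  rw [e, h2, Set.iUnion₂_mul]
  refine sep_biUnion hT _ (fun t ht => ?_)
  obtain ⟨h3, h4⟩ := h1 t ht
  rw [smul_mul_assoc]
  refine sep_translate ?_ _
  have hs1 := sep_preimage (QuotientGroup.mk' Z)
    (ncoset_list hQ (t.2.map (Subgroup.map (QuotientGroup.mk' Z))) (by simp [h3]) (by
      intro L hL
      obtain ⟨L', hL', rfl⟩ := List.mem_map.mp hL
      exact fg_map _ _ (h4 L' hL').1))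
  have hs2 : SeparableSubset ((M ⊔ K : Subgroup G) : Set G) := by
    intro g hg
    refine ⟨M, hMn, hMf, fun x hx h => hg ?_⟩
    exact (Subgroup.mul_mem_cancel_right _ (Subgroup.mem_sup_left hx)).mp h
  have hPM := P_le M t.2 (fun L hL => (h4 L hL).2)
  have := sep_inter hs1 hs2
  convert this using 1
  rw [P_map]
  ext g
  constructor
  · rintro ⟨p, hp, k, hk, rfl⟩
    refine ⟨⟨p, hp, ?_⟩, ?_⟩
    · exact QuotientGroup.eq.mpr (by simpa using hKZ hk)
    · exact Subgroup.mul_mem _ (Subgroup.mem_sup_left (hPM hp)) (Subgroup.mem_sup_right hk)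
  · rintro ⟨⟨p, hp, hpg⟩, hg⟩
    have hz : p⁻¹ * g ∈ Z := QuotientGroup.eq.mp hpg
    have hz2 : p⁻¹ * g ∈ M ⊔ K :=
      Subgroup.mul_mem _ (Subgroup.mem_sup_left (M.inv_mem (hPM hp))) hg
    obtain ⟨m, hm, k, hk, hmk⟩ := Subgroup.mem_sup_of_normal_left.mp hz2
    have hmZ : m ∈ Z := by
      rw [← hmk] at hz
      exact (Subgroup.mul_mem_cancel_right _ (hKZ hk)).mp hz
    refine ⟨p, hp, p⁻¹ * g, ?_, by simp⟩
    rw [← hmk]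
    exact K.mul_mem (hMZ m hm hmZ) hk
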